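/- (Abstract Hahn–Jordan decomposition) There exists q ∈ B which is strongly positive with respect to ψ and such that e − q is strongly negative with respect to ψ. -/

import Mathlib

/-- In a (Dedekind complete) Riesz space `E`, the band projection of `x` onto the
band generated by `u`, given by `P_u x = sup_n (x⁺ ⊓ n|u|) - sup_n (x⁻ ⊓ n|u|)`.
For a component `p` of a weak order unit this is the product `p x`. -/
noncomputable def bandProj {E : Type*} [AddCommGroup E] [ConditionallyCompleteLattice E]
    [CovariantClass E E (· + ·) (· ≤ ·)] (u x : E) : E :=
  sSup (Set.range fun n : ℕ => (x ⊔ 0) ⊓ n • |u|) -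
    sSup (Set.range fun n : ℕ => ((-x) ⊔ 0) ⊓ n • |u|)

/-- `p` is a component of the weak order unit `e`: `0 ≤ p ≤ e` and `p ∧ (e - p) = 0`. -/
def IsComponent {E : Type*} [AddCommGroup E] [Lattice E] (e p : E) : Prop :=
  0 ≤ p ∧ p ≤ e ∧ p ⊓ (e - p) = 0

/-- The setting of the abstract Hahn-Jordan decomposition: a Dedekind complete Riesz
space `E` with weak order unit `e`, a Dedekind complete Riesz subspace `G` of `E`
containing `e`, an order closed Boolean subalgebra `B` of the components of `e`
containing all components of `e` lying in `G`, and a map `ψ : B → G` which is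
`K_G(e)`-homogeneous, additive on disjoint components, order continuous and order
bounded. -/
structure HJSetup (E : Type*) [AddCommGroup E] [ConditionallyCompleteLattice E]
    [CovariantClass E E (· + ·) (· ≤ ·)] [Module ℝ E] [PosSMulMono ℝ E] where
  /-- the weak order unit -/
  e : E
  /-- the Dedekind complete Riesz subspace `G` -/
  G : Set E
  /-- the Boolean algebra `B` of components of `e` -/
  B : Set E
  /-- the map `ψ : B → G` (values outside `B` are irrelevant) -/
  ψ : E → E
  e_pos : 0 < e
  e_weak : ∀ x : E, 0 ≤ x → x ⊓ e = 0 → x = 0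
  G_zero : (0 : E) ∈ G
  G_add : ∀ x ∈ G, ∀ y ∈ G, x + y ∈ G
  G_neg : ∀ x ∈ G, -x ∈ G
  G_smul : ∀ (c : ℝ), ∀ x ∈ G, c • x ∈ G
  G_sup : ∀ x ∈ G, ∀ y ∈ G, x ⊔ y ∈ G
  G_inf : ∀ x ∈ G, ∀ y ∈ G, x ⊓ y ∈ G
  /-- `G` is Dedekind complete (order closed in `E`) -/
  G_ded : ∀ S ⊆ G, S.Nonempty → BddAbove S → sSup S ∈ G
  e_mem : e ∈ G
  B_comp : ∀ p ∈ B, IsComponent e p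
  B_zero : (0 : E) ∈ B
  B_top : e ∈ B
  B_sup : ∀ p ∈ B, ∀ q ∈ B, p ⊔ q ∈ B
  B_inf : ∀ p ∈ B, ∀ q ∈ B, p ⊓ q ∈ B
  B_compl : ∀ p ∈ B, e - p ∈ B
  /-- `K_G(e) ⊆ B` -/
  KG_sub : ∀ p, IsComponent e p → p ∈ G → p ∈ B
  /-- `B` is order closed in `E`: if a (downward directed) net in `B` decreases to `p`
  in `E`, then `p ∈ B` -/
  B_orderClosed : ∀ S ⊆ B, S.Nonempty → DirectedOn (· ≥ ·) S → sInf S ∈ B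
  ψ_mem : ∀ p ∈ B, ψ p ∈ G
  /-- (i) `ψ(pq) = q ψ(p)` for `p ∈ B`, `q ∈ K_G(e)` -/
  ψ_mul : ∀ p ∈ B, ∀ q, IsComponent e q → q ∈ G → ψ (p ⊓ q) = bandProj q (ψ p)
  /-- (ii) additivity on disjoint components -/
  ψ_add : ∀ p ∈ B, ∀ q ∈ B, p ⊓ q = 0 → ψ (p ⊔ q) = ψ p + ψ q
  /-- (iii) order continuity: if a net `(p_α)` in `B` decreases to `p` in `E`, then
  `ψ(p_α) → ψ(p)` in order -/
  ψ_ordCont : ∀ S ⊆ B, S.Nonempty → DirectedOn (· ≥ ·) S →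
    ∃ w : E → E, (∀ p ∈ S, ∀ q ∈ S, p ≤ q → w p ≤ w q) ∧
      sInf (w '' S) = 0 ∧ ∀ p ∈ S, |ψ p - ψ (sInf S)| ≤ w p
  /-- (iv) `ψ` is order bounded -/
  ψ_bdd : ∃ g : E, 0 ≤ g ∧ ∀ p ∈ B, |ψ p| ≤ g

namespace HJSetup

variable {E : Type*} [AddCommGroup E] [ConditionallyCompleteLattice E]
  [CovariantClass E E (· + ·) (· ≤ ·)] [Module ℝ E] [PosSMulMono ℝ E]

/-- `C(q) = {ψ(p) : p ∈ B, p ≤ q}`. -/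
def C (s : HJSetup E) (q : E) : Set E := {y | ∃ p ∈ s.B, p ≤ q ∧ y = s.ψ p}

/-- `α(q) = sup C(q)`. -/
noncomputable def alpha (s : HJSetup E) (q : E) : E := sSup (s.C q)

/-- `M(q) = {p ∈ B : p ≤ q, 2ψ(p) ≥ p α(q)}`. -/
def M (s : HJSetup E) (q : E) : Set E :=
  {p | p ∈ s.B ∧ p ≤ q ∧ bandProj p (s.alpha q) ≤ s.ψ p + s.ψ p}

/-- `q` is strongly positive with respect to `ψ`. -/
def StronglyPos (s : HJSetup E) (q : E) : Prop := ∀ p ∈ s.B, p ≤ q → 0 ≤ s.ψ p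

/-- `q` is strongly negative with respect to `ψ`. -/
def StronglyNeg (s : HJSetup E) (q : E) : Prop := ∀ p ∈ s.B, p ≤ q → s.ψ p ≤ 0

/-- `H = {p ∈ B : p strongly negative w.r.t. ψ}`. -/
def H (s : HJSetup E) : Set E := {p | p ∈ s.B ∧ s.StronglyNeg p}

end HJSetup

section LatticeOrderedGroup

variable {E : Type*} [AddCommGroup E] [Lattice E] [IsOrderedAddMonoid E]

theorem inf_add_le_inf_add_inf {a b c : E} (ha : 0 ≤ a) (hb : 0 ≤ b) (hc : 0 ≤ c) :
    a ⊓ (b + c) ≤ a ⊓ b + a ⊓ c := by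
  have h : a ⊓ (b + c) - a ⊓ c ≤ a ⊓ b := by
    rw [sub_le_iff_le_add, inf_add, add_inf, add_inf]
    refine le_inf (le_inf ?_ ?_) (le_inf ?_ inf_le_right)
    · exact inf_le_left.trans (le_add_of_nonneg_left ha)
    · exact inf_le_left.trans (le_add_of_nonneg_right hc)
    · exact inf_le_left.trans (le_add_of_nonneg_left hb)
  exact sub_le_iff_le_add.mp h

theorem inf_nsmul_eq_zero {a b : E} (ha : 0 ≤ a) (hb : 0 ≤ b) (h : a ⊓ b = 0) (n : ℕ) :
    a ⊓ n • b = 0 := by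
  induction n with
  | zero => simpa using ha
  | succ n ih =>
    refine le_antisymm ?_ (le_inf ha (nsmul_nonneg hb _))
    rw [succ_nsmul]
    simpa [ih, h] using inf_add_le_inf_add_inf ha (nsmul_nonneg hb n) hb

theorem sub_inf_eq_sup_sub (a b : E) : a - a ⊓ b = a ⊔ b - b := by
  rw [sub_eq_sub_iff_add_eq_add, add_comm (a ⊔ _), inf_add_sup]

end LatticeOrderedGroup

section DedekindComplete

variable {E : Type*} [AddCommGroup E] [ConditionallyCompleteLattice E]

/-- The component of `e` generated by `z`, for `0 ≤ z`. -/
noncomputable def generatedComponent (e z : E) : E :=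
  sSup (Set.range fun n : ℕ => n • z ⊓ e)

theorem bddAbove_range_nsmul_inf (e z : E) :
    BddAbove (Set.range fun n : ℕ => n • z ⊓ e) :=
  ⟨e, by rintro _ ⟨n, rfl⟩; exact inf_le_right⟩

theorem nsmul_inf_le_generatedComponent (e z : E) (n : ℕ) :
    n • z ⊓ e ≤ generatedComponent e z :=
  le_csSup (bddAbove_range_nsmul_inf e z) ⟨n, rfl⟩

theorem generatedComponent_le (e z : E) : generatedComponent e z ≤ e :=
  csSup_le (Set.range_nonempty _) (by rintro _ ⟨n, rfl⟩; exact inf_le_right)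

theorem generatedComponent_nonneg {e : E} (he : 0 ≤ e) (z : E) :
    0 ≤ generatedComponent e z := by
  simpa [he] using nsmul_inf_le_generatedComponent e z 0

variable [IsOrderedAddMonoid E]

theorem inf_sSup_le {S : Set E} (hne : S.Nonempty) (hb : BddAbove S) {a u : E}
    (h : ∀ x ∈ S, a ⊓ x ≤ u) : a ⊓ sSup S ≤ u := by
  have key : sSup S ≤ sSup S - a ⊓ sSup S + u := by
    refine csSup_le hne fun x hx => ?_
    have hx' : x ≤ sSup S := le_csSup hb hx
    have h1 : a ⊓ sSup S ≤ a ⊓ x + (sSup S - x) := by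
      rw [inf_add]
      exact inf_le_inf (le_add_of_nonneg_right (sub_nonneg.mpr hx')) (by simp)
    have h2 : a ⊓ sSup S + x ≤ u + sSup S := by
      calc a ⊓ sSup S + x ≤ a ⊓ x + (sSup S - x) + x := by gcongr
        _ = a ⊓ x + sSup S := by abel
        _ ≤ u + sSup S := by gcongr; exact h x hx
    calc x ≤ u + sSup S - a ⊓ sSup S := le_sub_iff_add_le'.mpr h2
      _ = _ := by abel
  have : sSup S + a ⊓ sSup S ≤ sSup S + u := by
    calc sSup S + a ⊓ sSup S ≤ (sSup S - a ⊓ sSup S + u) + a ⊓ sSup S := by gcongr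
      _ = _ := by abel
  exact le_of_add_le_add_left this

theorem inf_generatedComponent_eq_zero {e z a : E} (he : 0 ≤ e) (hz : 0 ≤ z) (ha : 0 ≤ a)
    (h : a ⊓ z = 0) : a ⊓ generatedComponent e z = 0 := by
  refine le_antisymm ?_ (le_inf ha (generatedComponent_nonneg he z))
  refine inf_sSup_le (Set.range_nonempty _) (bddAbove_range_nsmul_inf e z) ?_
  rintro _ ⟨n, rfl⟩
  exact (inf_le_inf_left a inf_le_left).trans (inf_nsmul_eq_zero ha hz h n).le

theorem isComponent_generatedComponent {e z : E} (he : 0 ≤ e) (hz : 0 ≤ z) :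
    IsComponent e (generatedComponent e z) := by
  set r := generatedComponent e z
  have hre : 0 ≤ e - r := sub_nonneg.mpr (generatedComponent_le e z)
  refine ⟨generatedComponent_nonneg he z, generatedComponent_le e z, ?_⟩
  rw [inf_comm]
  refine inf_generatedComponent_eq_zero he hz hre (le_antisymm ?_ (le_inf hre hz))
  suffices h : r ≤ r - (e - r) ⊓ z by simpa using h
  refine csSup_le (Set.range_nonempty _) ?_
  rintro _ ⟨n, rfl⟩
  rw [le_sub_iff_add_le]
  refine le_trans (le_inf ?_ ?_) (nsmul_inf_le_generatedComponent e z (n + 1))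
  · rw [succ_nsmul]
    exact add_le_add inf_le_left inf_le_right
  · calc n • z ⊓ e + (e - r) ⊓ z ≤ r + (e - r) :=
        add_le_add (nsmul_inf_le_generatedComponent e z n) inf_le_left
      _ = e := by abel

theorem sSup_inf_nsmul_generatedComponent {e z : E} (he : 0 ≤ e)
    (hweak : ∀ x : E, 0 ≤ x → x ⊓ e = 0 → x = 0) (hz : 0 ≤ z) :
    sSup (Set.range fun n : ℕ => z ⊓ n • generatedComponent e z) = z := by
  set r := generatedComponent e z
  have hr0 : 0 ≤ r := generatedComponent_nonneg he z
  set u := sSup (Set.range fun n : ℕ => z ⊓ n • r)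
  have hbdd : BddAbove (Set.range fun n : ℕ => z ⊓ n • r) :=
    ⟨z, by rintro _ ⟨n, rfl⟩; exact inf_le_left⟩
  have hle (n : ℕ) : z ⊓ n • r ≤ u := le_csSup hbdd ⟨n, rfl⟩
  have huz : u ≤ z :=
    csSup_le (Set.range_nonempty _) (by rintro _ ⟨n, rfl⟩; exact inf_le_left)
  have hu0 : 0 ≤ u := by simpa [hz] using hle 0
  have hv : 0 ≤ z - u := sub_nonneg.mpr huz
  have hvr : (z - u) ⊓ r = 0 := by
    refine le_antisymm ?_ (le_inf hv hr0)
    suffices h : u ≤ u - (z - u) ⊓ r by simpa using h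
    refine csSup_le (Set.range_nonempty _) ?_
    rintro _ ⟨n, rfl⟩
    rw [le_sub_iff_add_le]
    refine le_trans (le_inf ?_ ?_) (hle (n + 1))
    · calc z ⊓ n • r + (z - u) ⊓ r ≤ u + (z - u) := add_le_add (hle n) inf_le_left
        _ = z := by abel
    · rw [succ_nsmul]
      exact add_le_add inf_le_right inf_le_right
  have hv0 : z - u = 0 := by
    refine hweak _ hv (le_antisymm ?_ (le_inf hv he))
    rw [← hvr]
    refine le_inf inf_le_left (le_trans ?_ (nsmul_inf_le_generatedComponent e z 1))
    rw [one_nsmul]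
    exact inf_le_inf_right e (sub_le_self z hu0)
  exact (sub_eq_zero.mp hv0).symm

theorem bandProj_generatedComponent_sup_zero {e : E} (he : 0 ≤ e)
    (hweak : ∀ x : E, 0 ≤ x → x ⊓ e = 0 → x = 0) (x : E) :
    bandProj (generatedComponent e (x ⊔ 0)) x = x ⊔ 0 := by
  have hr0 : 0 ≤ generatedComponent e (x ⊔ 0) := generatedComponent_nonneg he _
  have hdisj : (-x ⊔ 0) ⊓ (x ⊔ 0) = 0 := by
    simpa [posPart_def, negPart_def, inf_comm] using posPart_inf_negPart_eq_zero x
  have hz (n : ℕ) : (-x ⊔ 0) ⊓ n • generatedComponent e (x ⊔ 0) = 0 :=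
    inf_nsmul_eq_zero le_sup_right hr0
      (inf_generatedComponent_eq_zero he le_sup_right le_sup_right hdisj) n
  unfold bandProj
  rw [abs_of_nonneg hr0, sSup_inf_nsmul_generatedComponent he hweak le_sup_right]
  simp [hz]

end DedekindComplete

namespace HJSetup

variable {E : Type*} [AddCommGroup E] [ConditionallyCompleteLattice E]
  [CovariantClass E E (· + ·) (· ≤ ·)] [Module ℝ E] [PosSMulMono ℝ E] (s : HJSetup E)

/-- Covariance of addition makes an ordered commutative group an ordered additive monoid. -/
theorem isOrderedAddMonoid (E : Type*) [AddCommGroup E] [PartialOrder E]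
    [CovariantClass E E (· + ·) (· ≤ ·)] : IsOrderedAddMonoid E where
  add_le_add_left _ _ h c := add_le_add_left h c

attribute [local instance] isOrderedAddMonoid

theorem B_nonneg {p : E} (hp : p ∈ s.B) : 0 ≤ p := (s.B_comp p hp).1

theorem B_sub {p q : E} (hp : p ∈ s.B) (hq : q ∈ s.B) (hqp : q ≤ p) : p - q ∈ s.B := by
  have h : p ⊓ (s.e - q) = p - q := by
    refine le_antisymm ?_
      (le_inf (sub_le_self _ (s.B_nonneg hq)) (sub_le_sub_right (s.B_comp p hp).2.1 q))
    rw [le_sub_iff_add_le, ← inf_add_sup]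
    have h1 : p ⊓ (s.e - q) ⊓ q ≤ 0 := by
      rw [← (s.B_comp q hq).2.2, inf_comm q]
      exact inf_le_inf_right q inf_le_right
    simpa using add_le_add h1 (sup_le (inf_le_left (a := p) (b := s.e - q)) hqp)
  exact h ▸ s.B_inf p hp _ (s.B_compl q hq)

theorem ψ_add_sub {p q : E} (hp : p ∈ s.B) (hq : q ∈ s.B) (hqp : q ≤ p) :
    s.ψ q + s.ψ (p - q) = s.ψ p := by
  have hpq := s.B_sub hp hq hqp
  have h0 : q ⊓ (p - q) = 0 := by
    refine le_antisymm ?_ (le_inf (s.B_nonneg hq) (s.B_nonneg hpq))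
    rw [← (s.B_comp q hq).2.2]
    exact inf_le_inf_left q (sub_le_sub_right (s.B_comp p hp).2.1 q)
  have h1 : q ⊔ (p - q) = p := by
    have := inf_add_sup q (p - q)
    rwa [h0, zero_add, add_sub_cancel] at this
  rw [← s.ψ_add q hq _ hpq h0, h1]

theorem ψ_zero : s.ψ 0 = 0 := by
  simpa using s.ψ_add_sub s.B_zero s.B_zero le_rfl

theorem G_nsmul {x : E} (hx : x ∈ s.G) (n : ℕ) : n • x ∈ s.G := by
  induction n with
  | zero => simpa using s.G_zero
  | succ n ih => simpa [succ_nsmul] using s.G_add _ ih _ hx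

theorem exists_ψ_eq_sup_zero {p : E} (hp : p ∈ s.B) :
    ∃ q ∈ s.B, q ≤ p ∧ s.ψ q = s.ψ p ⊔ 0 := by
  have he := s.e_pos.le
  set r := generatedComponent s.e (s.ψ p ⊔ 0)
  have hrc : IsComponent s.e r := isComponent_generatedComponent he le_sup_right
  have hrG : r ∈ s.G := by
    refine s.G_ded _ ?_ (Set.range_nonempty _) (bddAbove_range_nsmul_inf _ _)
    rintro _ ⟨n, rfl⟩
    exact s.G_inf _ (s.G_nsmul (s.G_sup _ (s.ψ_mem p hp) _ s.G_zero) n) _ s.e_mem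
  refine ⟨p ⊓ r, s.B_inf p hp r (s.KG_sub r hrc hrG), inf_le_left, ?_⟩
  rw [s.ψ_mul p hp r hrc hrG, bandProj_generatedComponent_sup_zero he s.e_weak]

theorem exists_ψ_eq_inf_zero {p : E} (hp : p ∈ s.B) :
    ∃ q ∈ s.B, q ≤ p ∧ s.ψ q = s.ψ p ⊓ 0 := by
  obtain ⟨q, hq, hqp, hψ⟩ := s.exists_ψ_eq_sup_zero hp
  refine ⟨p - q, s.B_sub hp hq hqp, sub_le_self _ (s.B_nonneg hq), ?_⟩
  have h := s.ψ_add_sub hp hq hqp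
  have h2 := inf_add_sup (s.ψ p) 0
  rw [hψ] at h
  rw [add_zero, add_comm] at h2
  exact add_left_cancel (h.trans h2.symm)

theorem le_ψ_sInf {S : Set E} (hS : S ⊆ s.B) (hne : S.Nonempty)
    (hdir : DirectedOn (· ≥ ·) S) {a : E} (h : ∀ p ∈ S, a ≤ s.ψ p) : a ≤ s.ψ (sInf S) := by
  obtain ⟨w, -, hw0, hw⟩ := s.ψ_ordCont S hS hne hdir
  rw [← sub_nonpos, ← hw0]
  refine le_csInf (hne.image w) ?_
  rintro _ ⟨p, hp, rfl⟩
  exact (sub_le_sub_right (h p hp) _).trans ((le_abs_self _).trans (hw p hp))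

theorem ψ_sInf_le {S : Set E} (hS : S ⊆ s.B)
    (hdir : DirectedOn (· ≥ ·) S) {p₀ a : E} (hp₀ : p₀ ∈ S)
    (h : ∀ p ∈ S, p ≤ p₀ → s.ψ p ≤ a) : s.ψ (sInf S) ≤ a := by
  obtain ⟨w, hmono, hw0, hw⟩ := s.ψ_ordCont S hS ⟨p₀, hp₀⟩ hdir
  rw [← sub_nonpos, ← hw0]
  refine le_csInf (Set.Nonempty.image w ⟨p₀, hp₀⟩) ?_
  rintro _ ⟨p, hp, rfl⟩
  obtain ⟨t, ht, htp, htp₀⟩ := hdir p hp p₀ hp₀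
  calc s.ψ (sInf S) - a ≤ s.ψ (sInf S) - s.ψ t := sub_le_sub_left (h t ht htp₀) _
    _ ≤ |s.ψ t - s.ψ (sInf S)| := by rw [abs_sub_comm]; exact le_abs_self _
    _ ≤ w t := hw t ht
    _ ≤ w p := hmono t ht p hp htp

theorem bddBelow_of_subset_B {S : Set E} (hS : S ⊆ s.B) : BddBelow S :=
  ⟨0, fun _ hx => s.B_nonneg (hS hx)⟩

/-- Every `p ∈ B` contains a strongly negative component whose `ψ`-value is at most `ψ p`. -/
theorem exists_stronglyNeg_le {p : E} (hp : p ∈ s.B) :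
    ∃ n ∈ s.B, n ≤ p ∧ s.ψ n ≤ s.ψ p ∧ s.StronglyNeg n := by
  let r : {x // x ∈ s.B ∧ x ≤ p ∧ s.ψ x ≤ s.ψ p} →
      {x // x ∈ s.B ∧ x ≤ p ∧ s.ψ x ≤ s.ψ p} → Prop :=
    fun a b => b.1 ≤ a.1 ∧ s.ψ b.1 ≤ s.ψ a.1
  obtain ⟨⟨m, hm, hmp, hmψ⟩, hmax⟩ : ∃ m, ∀ a, r m a → r a m := by
    refine exists_maximal_of_chains_bounded (fun c hc => ?_)
      (fun h₁ h₂ => ⟨h₂.1.trans h₁.1, h₂.2.trans h₁.2⟩)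
    rcases c.eq_empty_or_nonempty with rfl | ⟨x₀, hx₀⟩
    · exact ⟨⟨p, hp, le_rfl, le_rfl⟩, by simp⟩
    have hS : Subtype.val '' c ⊆ s.B := by rintro _ ⟨x, -, rfl⟩; exact x.2.1
    have hdir : DirectedOn (· ≥ ·) (Subtype.val '' c) := by
      rintro _ ⟨x, hx, rfl⟩ _ ⟨y, hy, rfl⟩
      by_cases hxy : x = y
      · exact ⟨x, ⟨x, hx, rfl⟩, le_rfl, hxy ▸ le_rfl⟩
      rcases hc hx hy hxy with h | h
      · exact ⟨y, ⟨y, hy, rfl⟩, h.1, le_rfl⟩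
      · exact ⟨x, ⟨x, hx, rfl⟩, le_rfl, h.1⟩
    have hle (x) (hx : x ∈ c) : sInf (Subtype.val '' c) ≤ x.1 :=
      csInf_le (s.bddBelow_of_subset_B hS) ⟨x, hx, rfl⟩
    have hψle (x) (hx : x ∈ c) : s.ψ (sInf (Subtype.val '' c)) ≤ s.ψ x.1 := by
      refine s.ψ_sInf_le hS hdir ⟨x, hx, rfl⟩ ?_
      rintro _ ⟨y, hy, rfl⟩ hyx
      by_cases hxy : x = y
      · rw [hxy]
      rcases hc hx hy hxy with h | h
      · exact h.2
      · rw [le_antisymm hyx h.1]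
    exact ⟨⟨sInf (Subtype.val '' c),
      s.B_orderClosed _ hS ⟨_, x₀, hx₀, rfl⟩ hdir, (hle x₀ hx₀).trans x₀.2.2.1,
      (hψle x₀ hx₀).trans x₀.2.2.2⟩, fun x hx => ⟨hle x hx, hψle x hx⟩⟩
  refine ⟨m, hm, hmp, hmψ, fun y hy hym => ?_⟩
  obtain ⟨y', hy', hyy', hψ⟩ := s.exists_ψ_eq_sup_zero hy
  have hy'm : y' ≤ m := hyy'.trans hym
  have hle : m - y' ≤ m := sub_le_self _ (s.B_nonneg hy')
  have hψle : s.ψ (m - y') ≤ s.ψ m := by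
    rw [← s.ψ_add_sub hm hy' hy'm, hψ]
    exact le_add_of_nonneg_left le_sup_right
  have h := (hmax ⟨m - y', s.B_sub hm hy' hy'm, hle.trans hmp, hψle.trans hmψ⟩
    ⟨hle, hψle⟩).1
  have hy0 : y' = 0 := le_antisymm (by simpa using h) (s.B_nonneg hy')
  rw [hy0, s.ψ_zero] at hψ
  exact le_sup_left.trans hψ.ge

/-- Among the `q ∈ B` with strongly negative complement there is a minimal one. -/
theorem exists_minimal_stronglyNeg_compl :
    ∃ q, Minimal (fun q => q ∈ s.B ∧ s.StronglyNeg (s.e - q)) q := by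
  let r : {q // q ∈ s.B ∧ s.StronglyNeg (s.e - q)} →
      {q // q ∈ s.B ∧ s.StronglyNeg (s.e - q)} → Prop := fun a b => b.1 ≤ a.1
  obtain ⟨m, hmax⟩ : ∃ m, ∀ a, r m a → r a m := by
    refine exists_maximal_of_chains_bounded (fun c hc => ?_) (fun h₁ h₂ => le_trans h₂ h₁)
    rcases c.eq_empty_or_nonempty with rfl | hne
    · refine ⟨⟨s.e, s.B_top, fun p hp hpe => ?_⟩, by simp⟩
      rw [le_antisymm (by simpa using hpe) (s.B_nonneg hp), s.ψ_zero]
    set S : Set E := Subtype.val '' c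
    have hS : S ⊆ s.B := by rintro _ ⟨x, -, rfl⟩; exact x.2.1
    have hdir : DirectedOn (· ≥ ·) S := by
      rintro _ ⟨x, hx, rfl⟩ _ ⟨y, hy, rfl⟩
      by_cases hxy : x = y
      · exact ⟨x, ⟨x, hx, rfl⟩, le_rfl, hxy ▸ le_rfl⟩
      rcases hc hx hy hxy with h | h
      · exact ⟨y, ⟨y, hy, rfl⟩, h, le_rfl⟩
      · exact ⟨x, ⟨x, hx, rfl⟩, le_rfl, h⟩
    have hSB : sInf S ∈ s.B := s.B_orderClosed S hS (hne.image _) hdir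
    refine ⟨⟨sInf S, hSB, fun p hp hpS => ?_⟩,
      fun x hx => csInf_le (s.bddBelow_of_subset_B hS) ⟨x, hx, rfl⟩⟩
    have hTB : (fun x => p ⊓ x) '' S ⊆ s.B := by
      rintro _ ⟨x, hx, rfl⟩
      exact s.B_inf p hp x (hS hx)
    have hTdir : DirectedOn (· ≥ ·) ((fun x => p ⊓ x) '' S) := by
      rintro _ ⟨x, hx, rfl⟩ _ ⟨y, hy, rfl⟩
      obtain ⟨z, hz, hzx, hzy⟩ := hdir x hx y hy
      exact ⟨p ⊓ z, ⟨z, hz, rfl⟩, inf_le_inf_left p hzx, inf_le_inf_left p hzy⟩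
    have hTne : ((fun x => p ⊓ x) '' S).Nonempty := (hne.image _).image _
    have hT0 : sInf ((fun x => p ⊓ x) '' S) = 0 := by
      refine le_antisymm ?_ (le_csInf hTne fun x hx => s.B_nonneg (hTB hx))
      rw [← (s.B_comp _ hSB).2.2]
      refine le_inf (le_csInf (hne.image _) fun x hx => ?_) (le_trans ?_ hpS)
      · exact (csInf_le (s.bddBelow_of_subset_B hTB) ⟨x, hx, rfl⟩).trans inf_le_right
      · obtain ⟨x, hx⟩ := hne.image (Subtype.val : _ → E)
        exact (csInf_le (s.bddBelow_of_subset_B hTB) ⟨x, hx, rfl⟩).trans inf_le_left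
    have h := s.le_ψ_sInf hTB hTne hTdir (a := s.ψ p) ?_
    · rwa [hT0, s.ψ_zero] at h
    rintro _ ⟨x, ⟨q, hq, rfl⟩, rfl⟩
    have hpq : p ⊓ q.1 ∈ s.B := s.B_inf p hp _ q.2.1
    rw [← s.ψ_add_sub hp hpq inf_le_left]
    refine add_le_of_nonpos_right (q.2.2 _ (s.B_sub hp hpq inf_le_left) ?_)
    rw [sub_inf_eq_sup_sub]
    exact sub_le_sub_right (sup_le (s.B_comp p hp).2.1 (s.B_comp _ q.2.1).2.1) _
  exact ⟨m.1, m.2, fun q hq hqm => hmax ⟨q, hq⟩ hqm⟩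

theorem StronglyNeg.add {s : HJSetup E} {p n : E} (hp : s.StronglyNeg p) (hn : s.StronglyNeg n)
    (hp0 : 0 ≤ p) (hnB : n ∈ s.B) : s.StronglyNeg (p + n) := by
  intro z hz hzpn
  have hzn : z ⊓ n ∈ s.B := s.B_inf z hz n hnB
  rw [← s.ψ_add_sub hz hzn inf_le_left]
  refine add_nonpos (hn _ hzn inf_le_right) (hp _ (s.B_sub hz hzn inf_le_left) ?_)
  rw [sub_inf_eq_sup_sub, sub_le_iff_le_add]
  exact sup_le hzpn (le_add_of_nonneg_left hp0)

end HJSetup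

/-- Abstract Hahn-Jordan decomposition: there exists `q ∈ B` which is
strongly positive with respect to `ψ` and such that `e - q` is strongly negative with
respect to `ψ`. -/
theorem hj_hahn_jordan {E : Type*} [AddCommGroup E]
    [ConditionallyCompleteLattice E] [CovariantClass E E (· + ·) (· ≤ ·)]
    [Module ℝ E] [PosSMulMono ℝ E] (s : HJSetup E) :
    ∃ q ∈ s.B, s.StronglyPos q ∧ s.StronglyNeg (s.e - q) := by
  have : IsOrderedAddMonoid E := HJSetup.isOrderedAddMonoid E
  obtain ⟨q, ⟨hq, hqneg⟩, hmin⟩ := s.exists_minimal_stronglyNeg_compl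
  refine ⟨q, hq, fun p hp hpq => ?_, hqneg⟩
  obtain ⟨p', hp', hpp', hψ⟩ := s.exists_ψ_eq_inf_zero hp
  obtain ⟨n, hn, hnp', hnψ, hneg⟩ := s.exists_stronglyNeg_le hp'
  have hnq : n ≤ q := hnp'.trans (hpp'.trans hpq)
  have hneg' : s.StronglyNeg (s.e - (q - n)) := by
    rw [← sub_add]
    exact hqneg.add hneg (sub_nonneg.mpr (s.B_comp q hq).2.1) hn
  have h := hmin ⟨s.B_sub hq hn hnq, hneg'⟩ (sub_le_self _ (s.B_nonneg hn))
  have hn0 : n = 0 := le_antisymm (by simpa using h) (s.B_nonneg hn)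
  rw [hn0, s.ψ_zero, hψ] at hnψ
  exact hnψ.trans inf_le_left
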